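/- arXiv:2302.09962 — 3 statements merged into one kernel-verified Lean document; each statement's English description precedes it below -/
import Mathlib

section
/- Let M ≥ 0, 0 < θ < π/2 and 1/3 < δ < 1/2 be fixed, let |r| ≤ M, and let w(u) = arcsin(sin θ · u/sinh u) with w(0) = θ. Then (1/2) ∫_{−y^{−δ}}^{y^{−δ}} exp(−y(cosh u · cos w(u) + w(u) sin θ)) · e^{ru} · e^{i r w(u)} · (1 + i w'(u)) du ∼ sqrt(π/(2 y cos θ)) · exp(−y(cos θ + θ sin θ)) · e^{irθ} as y → ∞. -/
open MeasureTheory Filter Topology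

/-- The steepest-descent height function `w(u) = arcsin(sin θ · u / sinh u)` with `w(0) = θ`. -/
noncomputable def wSD (θ u : ℝ) : ℝ :=
  if u = 0 then θ else Real.arcsin (Real.sin θ * u / Real.sinh u)

/-- **Laplace's method** on shrinking neighbourhoods of a nondegenerate minimum at `0`. -/
theorem tendsto_sqrt_mul_integral_exp_neg_mul {h : ℝ → ℝ} {g : ℝ → ℂ} {ρ : ℝ → ℝ} {a : ℝ} {L : ℂ}
    (hh : Measurable h) (hg : Measurable g) (ha : 0 < a)
    (hlim : Tendsto (fun u => (h u - h 0) / u ^ 2) (𝓝[≠] 0) (𝓝 a))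
    (hgL : Tendsto g (𝓝 0) (𝓝 L)) (hρ : Tendsto ρ atTop (𝓝 0))
    (hρy : Tendsto (fun y => ρ y * √y) atTop atTop) :
    Tendsto (fun y : ℝ => ((√y : ℝ) : ℂ) *
        ∫ u in (-(ρ y))..(ρ y), ((Real.exp (-(y * (h u - h 0))) : ℝ) : ℂ) * g u)
      atTop (𝓝 (((√(Real.pi / a) : ℝ) : ℂ) * L)) := by
  set F : ℝ → ℝ → ℂ := fun y t => (Set.Ioc (-(ρ y * √y)) (ρ y * √y)).indicator
    (fun t => ((Real.exp (-(y * (h (t / √y) - h 0))) : ℝ) : ℂ) * g (t / √y)) t with hF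
  have hscale : ∀ᶠ y in atTop, ∫ t, F y t = ((√y : ℝ) : ℂ) *
      ∫ u in (-(ρ y))..(ρ y), ((Real.exp (-(y * (h u - h 0))) : ℝ) : ℂ) * g u := by
    filter_upwards [eventually_gt_atTop 0, hρy.eventually_ge_atTop 0] with y hy hy'
    have hs : √y ≠ 0 := (Real.sqrt_pos.2 hy).ne'
    have key := intervalIntegral.integral_comp_div (a := -(ρ y * √y)) (b := ρ y * √y)
      (fun u => ((Real.exp (-(y * (h u - h 0))) : ℝ) : ℂ) * g u) hs
    rw [neg_div, mul_div_cancel_right₀ _ hs, Complex.real_smul] at key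
    rw [← key, intervalIntegral.integral_of_le (by linarith), hF,
      integral_indicator measurableSet_Ioc]
  refine Tendsto.congr' hscale ?_
  have hquad : ∀ᶠ u in 𝓝 (0 : ℝ), a / 2 * u ^ 2 ≤ h u - h 0 := by
    have h1 : ∀ᶠ u in 𝓝[≠] (0 : ℝ), a / 2 < (h u - h 0) / u ^ 2 :=
      hlim.eventually (lt_mem_nhds (by linarith))
    rw [eventually_nhdsWithin_iff] at h1
    filter_upwards [h1] with u hu
    rcases eq_or_ne u 0 with rfl | hu0
    · simp
    · exact ((lt_div_iff₀ (by positivity)).1 (hu hu0)).le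
  have hbdd : ∀ᶠ u in 𝓝 (0 : ℝ), ‖g u‖ ≤ ‖L‖ + 1 :=
    (hgL.norm.eventually (gt_mem_nhds (lt_add_one _))).mono fun _ => le_of_lt
  obtain ⟨ε, hε, hball⟩ := Metric.eventually_nhds_iff.1 (hquad.and hbdd)
  have hInt : ∫ t : ℝ, ((Real.exp (-a * t ^ 2) : ℝ) : ℂ) * L = ((√(Real.pi / a) : ℝ) : ℂ) * L := by
    rw [integral_mul_const, integral_complex_ofReal, integral_gaussian]
  rw [← hInt]
  have hdiv : ∀ t : ℝ, Tendsto (fun y : ℝ => t / √y) atTop (𝓝 0) := fun t =>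
    tendsto_const_nhds.div_atTop Real.tendsto_sqrt_atTop
  refine tendsto_integral_filter_of_dominated_convergence
    (fun t => Real.exp (-(a / 2) * t ^ 2) * (‖L‖ + 1)) ?_ ?_ ?_ ?_
  · refine Eventually.of_forall fun y => Measurable.aestronglyMeasurable ?_
    exact Measurable.indicator (by fun_prop) measurableSet_Ioc
  · filter_upwards [eventually_gt_atTop 0, hρ.eventually (gt_mem_nhds hε)] with y hy hyε
    refine Eventually.of_forall fun t => ?_
    have hs := Real.sqrt_pos.2 hy
    by_cases ht : t ∈ Set.Ioc (-(ρ y * √y)) (ρ y * √y)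
    · have habs : dist (t / √y) 0 < ε := by
        rw [Real.dist_0_eq_abs, abs_div, abs_of_pos hs, div_lt_iff₀ hs]
        exact (abs_le.2 ⟨ht.1.le, ht.2⟩).trans_lt (by gcongr)
      obtain ⟨h1, h2⟩ := hball habs
      simp only [hF, Set.indicator_of_mem ht, norm_mul, Complex.norm_real, Real.norm_eq_abs,
        Real.abs_exp]
      gcongr
      have h3 := mul_le_mul_of_nonneg_left h1 hy.le
      rw [div_pow, Real.sq_sqrt hy.le] at h3
      have h4 : y * (a / 2 * (t ^ 2 / y)) = a / 2 * t ^ 2 := by field_simp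
      linarith
    · simp only [hF, Set.indicator_of_notMem ht, norm_zero]
      positivity
  · exact (integrable_exp_neg_mul_sq (by positivity)).mul_const _
  · refine Eventually.of_forall fun t => ?_
    have hmem : ∀ᶠ y in atTop, ((Real.exp (-(y * (h (t / √y) - h 0))) : ℝ) : ℂ) * g (t / √y)
        = F y t := by
      filter_upwards [hρy.eventually_gt_atTop |t|] with y hy
      have ht := abs_lt.1 hy
      simp only [hF]
      rw [Set.indicator_of_mem (Set.mem_Ioc.2 ⟨ht.1, ht.2.le⟩)]
    refine Tendsto.congr' hmem (Tendsto.mul ?_ (hgL.comp (hdiv t)))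
    refine (Complex.continuous_ofReal.tendsto _).comp ((Real.continuous_exp.tendsto _).comp ?_)
    rw [neg_mul]
    refine Tendsto.neg ?_
    rcases eq_or_ne t 0 with rfl | ht
    · simp
    · have hne : Tendsto (fun y : ℝ => t / √y) atTop (𝓝[≠] 0) := by
        refine tendsto_nhdsWithin_iff.2 ⟨hdiv t, ?_⟩
        filter_upwards [eventually_gt_atTop 0] with y hy
        exact div_ne_zero ht (Real.sqrt_pos.2 hy).ne'
      refine ((hlim.comp hne).mul_const (t ^ 2)).congr' ?_
      filter_upwards [eventually_gt_atTop 0] with y hy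
      simp only [Function.comp, div_pow, Real.sq_sqrt hy.le]
      field_simp

theorem wSD_zero (θ : ℝ) : wSD θ 0 = θ := if_pos rfl

theorem wSD_neg (θ u : ℝ) : wSD θ (-u) = wSD θ u := by
  simp only [wSD, neg_eq_zero, Real.sinh_neg, mul_neg, neg_div_neg_eq]

theorem measurable_wSD (θ : ℝ) : Measurable (wSD θ) :=
  Measurable.ite (measurableSet_singleton 0) measurable_const
    (Real.measurable_arcsin.comp (by fun_prop))

theorem deriv_wSD_zero (θ : ℝ) : deriv (wSD θ) 0 = 0 := by
  have h := deriv_comp_neg (f := wSD θ) (x := (0 : ℝ))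
  simp only [wSD_neg, neg_zero] at h
  have h' : deriv (wSD θ) 0 = -deriv (wSD θ) 0 := h
  linarith

theorem analyticAt_wSD {θ : ℝ} (h₁ : -(Real.pi / 2) < θ) (h₂ : θ < Real.pi / 2) :
    AnalyticAt ℝ (wSD θ) 0 := by
  have hd0 : dslope Real.sinh 0 0 = 1 := by simp [Real.deriv_sinh]
  have hw : wSD θ = Real.arcsin ∘ fun u => Real.sin θ / dslope Real.sinh 0 u := by
    funext u
    rcases eq_or_ne u 0 with rfl | hu
    · rw [Function.comp, hd0, div_one, wSD_zero, Real.arcsin_sin h₁.le h₂.le]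
    · rw [Function.comp, dslope_of_ne _ hu, slope_def_field, wSD, if_neg hu]
      simp [div_div_eq_mul_div]
  have hds : AnalyticAt ℝ (dslope Real.sinh 0) 0 := by
    obtain ⟨p, hp⟩ := (Real.analyticAt_sinh : AnalyticAt ℝ Real.sinh 0)
    exact ⟨_, hp.has_fpower_series_dslope_fslope⟩
  rw [hw]
  refine AnalyticAt.comp ?_ (analyticAt_const.div hds (by rw [hd0]; exact one_ne_zero))
  have hc : 0 < Real.cos θ := Real.cos_pos_of_mem_Ioo ⟨h₁, h₂⟩
  have hsq := Real.sin_sq_add_cos_sq θ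
  rw [hd0, div_one]
  refine (Real.contDiffAt_arcsin ?_ ?_).analyticAt <;> intro h <;> rw [h] at hsq <;> nlinarith

/-- The phase along the steepest-descent path is quadratic at the saddle point. -/
theorem tendsto_phase_wSD {θ : ℝ} (h₁ : -(Real.pi / 2) < θ) (h₂ : θ < Real.pi / 2) :
    Tendsto (fun u => (Real.cosh u * Real.cos (wSD θ u) + wSD θ u * Real.sin θ -
        (Real.cosh 0 * Real.cos (wSD θ 0) + wSD θ 0 * Real.sin θ)) / u ^ 2)
      (𝓝[≠] 0) (𝓝 (Real.cos θ / 2)) := by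
  have hw := analyticAt_wSD h₁ h₂
  have hwd : HasDerivAt (wSD θ) 0 0 := by
    simpa only [deriv_wSD_zero] using hw.differentiableAt.hasDerivAt
  have hev : ∀ᶠ u in 𝓝[≠] (0 : ℝ), HasDerivAt (wSD θ) (deriv (wSD θ) u) u :=
    (hw.eventually_analyticAt.filter_mono nhdsWithin_le_nhds).mono
      fun u hu => hu.differentiableAt.hasDerivAt
  refine HasDerivAt.lhopital_zero_nhdsNE
    (f' := fun u => Real.sinh u * Real.cos (wSD θ u) +
      Real.cosh u * (-Real.sin (wSD θ u) * deriv (wSD θ) u) + deriv (wSD θ) u * Real.sin θ)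
    (g' := fun u => 2 * u) ?_ ?_ ?_ ?_ ?_ ?_
  · filter_upwards [hev] with u hu
    exact (((Real.hasDerivAt_cosh u).mul hu.cos).add (hu.mul_const _)).sub_const _
  · exact Eventually.of_forall fun u => by simpa using hasDerivAt_pow 2 u
  · filter_upwards [self_mem_nhdsWithin] with u hu
    exact mul_ne_zero two_ne_zero hu
  · have hc : ContinuousAt (fun u => Real.cosh u * Real.cos (wSD θ u) + wSD θ u * Real.sin θ -
        (Real.cosh 0 * Real.cos (wSD θ 0) + wSD θ 0 * Real.sin θ)) 0 := by
      have := hw.continuousAt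
      have := Real.continuous_cosh.continuousAt (x := 0)
      fun_prop
    have ht := hc.tendsto
    rw [sub_self] at ht
    exact ht.mono_left nhdsWithin_le_nhds
  · have hc : ContinuousAt (fun u : ℝ => u ^ 2) 0 := by fun_prop
    simpa using hc.tendsto.mono_left nhdsWithin_le_nhds
  · have hsinh : Tendsto (slope Real.sinh 0) (𝓝[≠] 0) (𝓝 1) := by
      simpa using hasDerivAt_iff_tendsto_slope.1 (Real.hasDerivAt_sinh 0)
    have hcs : Tendsto (slope (fun u => Real.cosh u * Real.sin (wSD θ u)) 0) (𝓝[≠] 0) (𝓝 0) := by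
      have := hasDerivAt_iff_tendsto_slope.1 ((Real.hasDerivAt_cosh 0).mul hwd.sin)
      simp only [Real.sinh_zero, zero_mul, mul_zero, add_zero] at this
      exact this
    have hdw : Tendsto (deriv (wSD θ)) (𝓝[≠] 0) (𝓝 0) := by
      have := hw.deriv.continuousAt.tendsto
      rw [deriv_wSD_zero] at this
      exact this.mono_left nhdsWithin_le_nhds
    have hcos : Tendsto (fun u => Real.cos (wSD θ u)) (𝓝[≠] 0) (𝓝 (Real.cos θ)) := by
      have := (Real.continuous_cos.continuousAt.comp hw.continuousAt).tendsto
      rw [Function.comp_apply, wSD_zero] at this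
      exact this.mono_left nhdsWithin_le_nhds
    have hlim := ((hsinh.mul hcos).sub (hcs.mul hdw)).div_const 2
    rw [one_mul, zero_mul, sub_zero] at hlim
    refine hlim.congr' ?_
    filter_upwards [self_mem_nhdsWithin] with u hu
    have hu' : u ≠ 0 := hu
    simp only [slope_def_field, Real.sinh_zero, Real.cosh_zero, wSD_zero]
    field_simp
    ring

theorem saddle_point_neighborhood_dominant_term (M θ δ : ℝ) (hM : 0 ≤ M)
    (hθ0 : 0 < θ) (hθ : θ < Real.pi / 2) (hδ1 : 1 / 3 < δ) (hδ2 : δ < 1 / 2)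
    (r : ℝ) (hr : |r| ≤ M) :
    Tendsto (fun y : ℝ =>
      ((1 / 2) * ∫ u in (-(y ^ (-δ)))..(y ^ (-δ)),
        Complex.exp (-(y : ℂ) *
            ((Real.cosh u * Real.cos (wSD θ u) + wSD θ u * Real.sin θ : ℝ) : ℂ)) *
          Complex.exp ((r : ℂ) * (u : ℂ)) *
          Complex.exp (Complex.I * (r : ℂ) * ((wSD θ u : ℝ) : ℂ)) *
          (1 + Complex.I * ((deriv (wSD θ) u : ℝ) : ℂ))) /
        (((Real.sqrt (Real.pi / (2 * y * Real.cos θ)) : ℝ) : ℂ) *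
          Complex.exp (((-(y * (Real.cos θ + θ * Real.sin θ)) : ℝ) : ℂ)) *
          Complex.exp (Complex.I * (r : ℂ) * (θ : ℂ))))
      atTop (𝓝 1) := by
  have hθ' : -(Real.pi / 2) < θ := by linarith [Real.pi_pos]
  have hcos : 0 < Real.cos θ := Real.cos_pos_of_mem_Ioo ⟨hθ', hθ⟩
  have hw := analyticAt_wSD hθ' hθ
  have hwm := measurable_wSD θ
  set h : ℝ → ℝ := fun u => Real.cosh u * Real.cos (wSD θ u) + wSD θ u * Real.sin θ with hh
  set g : ℝ → ℂ := fun u => Complex.exp ((r : ℂ) * (u : ℂ)) *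
    Complex.exp (Complex.I * (r : ℂ) * ((wSD θ u : ℝ) : ℂ)) *
    (1 + Complex.I * ((deriv (wSD θ) u : ℝ) : ℂ)) with hg
  have hh0 : h 0 = Real.cos θ + θ * Real.sin θ := by simp [hh, wSD_zero]
  have hgm : Measurable g := by
    have := measurable_deriv (wSD θ)
    fun_prop
  have hgL : Tendsto g (𝓝 0) (𝓝 (Complex.exp (Complex.I * (r : ℂ) * (θ : ℂ)))) := by
    have hc : ContinuousAt g 0 := by
      have := hw.continuousAt
      have := hw.deriv.continuousAt
      fun_prop
    simpa [hg, wSD_zero, deriv_wSD_zero] using hc.tendsto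
  have hρy : Tendsto (fun y : ℝ => y ^ (-δ) * √y) atTop atTop := by
    refine (tendsto_rpow_atTop (y := 1 / 2 - δ) (by linarith)).congr' ?_
    filter_upwards [eventually_gt_atTop 0] with y hy
    rw [Real.sqrt_eq_rpow, ← Real.rpow_add hy]
    congr 1
    ring
  have key := tendsto_sqrt_mul_integral_exp_neg_mul (h := h) (by fun_prop) hgm (half_pos hcos)
    (tendsto_phase_wSD hθ' hθ) hgL (tendsto_rpow_neg_atTop (by linarith : 0 < δ)) hρy
  have hpos : 0 < √(Real.pi / (Real.cos θ / 2)) := by positivity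
  have hne : ((√(Real.pi / (Real.cos θ / 2)) : ℝ) : ℂ) *
      Complex.exp (Complex.I * (r : ℂ) * (θ : ℂ)) ≠ 0 :=
    mul_ne_zero (Complex.ofReal_ne_zero.2 hpos.ne') (Complex.exp_ne_zero _)
  have key' := key.div_const (((√(Real.pi / (Real.cos θ / 2)) : ℝ) : ℂ) *
      Complex.exp (Complex.I * (r : ℂ) * (θ : ℂ)))
  rw [div_self hne] at key'
  refine key'.congr' ?_
  filter_upwards [eventually_gt_atTop 0] with y hy
  have hfactor : ∀ u : ℝ, Complex.exp (-(y : ℂ) *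
        ((Real.cosh u * Real.cos (wSD θ u) + wSD θ u * Real.sin θ : ℝ) : ℂ)) *
      Complex.exp ((r : ℂ) * (u : ℂ)) * Complex.exp (Complex.I * (r : ℂ) * ((wSD θ u : ℝ) : ℂ)) *
      (1 + Complex.I * ((deriv (wSD θ) u : ℝ) : ℂ)) =
      Complex.exp (((-(y * h 0) : ℝ)) : ℂ) *
        (((Real.exp (-(y * (h u - h 0))) : ℝ) : ℂ) * g u) := fun u => by
    have hexp : Complex.exp (-(y : ℂ) * (h u : ℂ)) = Complex.exp (((-(y * h 0) : ℝ)) : ℂ) *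
        ((Real.exp (-(y * (h u - h 0))) : ℝ) : ℂ) := by
      rw [Complex.ofReal_exp, ← Complex.exp_add]
      congr 1
      push_cast
      ring
    change Complex.exp (-(y : ℂ) * (h u : ℂ)) * _ * _ * _ = _
    rw [hexp, hg]
    ring
  have hsqrt : √(Real.pi / (2 * y * Real.cos θ)) =
      √(Real.pi / (Real.cos θ / 2)) / (2 * √y) := by
    have h2 : Real.pi / (2 * y * Real.cos θ) = Real.pi / (Real.cos θ / 2) / (2 ^ 2 * y) := by
      field_simp
    rw [h2, Real.sqrt_div (by positivity), Real.sqrt_mul (by positivity),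
      Real.sqrt_sq (by positivity)]
  have hs : ((√y : ℝ) : ℂ) ≠ 0 := Complex.ofReal_ne_zero.2 (Real.sqrt_pos.2 hy).ne'
  have hE := Complex.exp_ne_zero (((-(y * h 0) : ℝ)) : ℂ)
  simp_rw [hfactor]
  rw [intervalIntegral.integral_const_mul, ← hh0, hsqrt]
  generalize (∫ u in (-(y ^ (-δ)))..(y ^ (-δ)),
    ((Real.exp (-(y * (h u - h 0))) : ℝ) : ℂ) * g u) = J
  rw [Complex.ofReal_div, Complex.ofReal_mul]
  push_cast at hE ⊢
  field_simp
end

section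
/- Let M ≥ 0 and 1/4 < δ < 1/3 be fixed, let |r| ≤ M, and let w(u) = arcsin(u/sinh u) with w(0) = π/2. Then (1/2) ∫_{−y^{−δ}}^{y^{−δ}} exp(−y(cosh u · cos w(u) + w(u))) · e^{ru} · e^{i r w(u)} · (1 + i w'(u)) du ∼ exp(−(π/2) y + i (π/2) r) · y^{−1/3} · Γ(1/3)/(2^{2/3} 3^{1/6}) as y → ∞, where Γ is the gamma function. -/
open MeasureTheory Filter Topology

/-- The steepest-descent height function for the case `θ = π/2`:
`w(u) = arcsin(u / sinh u)` with `w(0) = π/2`. -/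
noncomputable def wSD2 (u : ℝ) : ℝ :=
  if u = 0 then Real.pi / 2 else Real.arcsin (u / Real.sinh u)

theorem tendsto_sinh_div_self : Tendsto (fun x : ℝ => Real.sinh x / x) (𝓝[≠] 0) (𝓝 1) := by
  have h := (Real.hasDerivAt_sinh 0).tendsto_slope
  rw [Real.cosh_zero] at h
  refine h.congr fun x => ?_
  simp [slope_def_field]

theorem tendsto_sin_div_self : Tendsto (fun x : ℝ => Real.sin x / x) (𝓝[≠] 0) (𝓝 1) := by
  have h := (Real.hasDerivAt_sin 0).tendsto_slope
  rw [Real.cos_zero] at h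
  refine h.congr fun x => ?_
  simp [slope_def_field]

theorem tendsto_half_punctured : Tendsto (fun x : ℝ => x / 2) (𝓝[≠] 0) (𝓝[≠] 0) := by
  refine tendsto_nhdsWithin_iff.2 ⟨?_, ?_⟩
  · have : Tendsto (fun x : ℝ => x / 2) (𝓝 0) (𝓝 (0 / 2)) := tendsto_id.div_const 2
    rw [zero_div] at this
    exact this.mono_left nhdsWithin_le_nhds
  · filter_upwards [self_mem_nhdsWithin] with x hx
    simpa using hx

theorem tendsto_cosh_sub_one_div_sq :
    Tendsto (fun x : ℝ => (Real.cosh x - 1) / x ^ 2) (𝓝[≠] 0) (𝓝 (1 / 2)) := by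
  have h := ((tendsto_sinh_div_self.comp tendsto_half_punctured).pow 2).div_const 2
  rw [one_pow] at h
  refine h.congr' ?_
  filter_upwards [self_mem_nhdsWithin] with x hx
  have hx : x ≠ 0 := hx
  have h2 := Real.cosh_two_mul (x / 2)
  rw [mul_div_cancel₀ x two_ne_zero] at h2
  have h3 := Real.cosh_sq (x / 2)
  simp only [Function.comp]
  field_simp
  linarith

theorem tendsto_cos_sub_one_div_sq :
    Tendsto (fun x : ℝ => (Real.cos x - 1) / x ^ 2) (𝓝[≠] 0) (𝓝 (-(1 / 2))) := by
  have h := (((tendsto_sin_div_self.comp tendsto_half_punctured).pow 2).div_const 2).neg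
  rw [one_pow] at h
  refine h.congr' ?_
  filter_upwards [self_mem_nhdsWithin] with x hx
  have hx : x ≠ 0 := hx
  have h2 := Real.cos_two_mul (x / 2)
  rw [mul_div_cancel₀ x two_ne_zero] at h2
  have h3 := Real.cos_sq' (x / 2)
  simp only [Function.comp]
  field_simp
  linarith

/-- One step of L'Hôpital's rule against a cubic denominator. -/
theorem tendsto_sub_self_div_cube {f f' : ℝ → ℝ} {a : ℝ} (hf : ∀ x, HasDerivAt f (f' x) x)
    (h0 : f 0 = 0) (ha : Tendsto (fun x => (f' x - 1) / x ^ 2) (𝓝[≠] 0) (𝓝 a)) :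
    Tendsto (fun x => (f x - x) / x ^ 3) (𝓝[≠] 0) (𝓝 (a / 3)) := by
  refine HasDerivAt.lhopital_zero_nhdsNE (f' := fun x => f' x - 1) (g' := fun x => 3 * x ^ 2)
    ?_ ?_ ?_ ?_ ?_ ?_
  · exact Eventually.of_forall fun x => (hf x).sub (hasDerivAt_id x)
  · exact Eventually.of_forall fun x => by simpa using hasDerivAt_pow 3 x
  · filter_upwards [self_mem_nhdsWithin] with x hx
    have hx : x ≠ 0 := hx
    positivity
  · have : Tendsto (fun x => f x - x) (𝓝 0) (𝓝 (f 0 - 0)) :=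
      (hf 0).continuousAt.tendsto.sub tendsto_id
    rw [h0, sub_zero] at this
    exact this.mono_left nhdsWithin_le_nhds
  · have : Tendsto (fun x : ℝ => x ^ 3) (𝓝 0) (𝓝 (0 ^ 3)) := tendsto_id.pow 3
    rw [zero_pow three_ne_zero] at this
    exact this.mono_left nhdsWithin_le_nhds
  · refine (ha.div_const 3).congr fun x => ?_
    rw [div_div, mul_comm]

theorem tendsto_sinh_sub_self_div_cube :
    Tendsto (fun x : ℝ => (Real.sinh x - x) / x ^ 3) (𝓝[≠] 0) (𝓝 (1 / 2 / 3)) :=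
  tendsto_sub_self_div_cube Real.hasDerivAt_sinh Real.sinh_zero tendsto_cosh_sub_one_div_sq

theorem tendsto_sin_sub_self_div_cube :
    Tendsto (fun x : ℝ => (Real.sin x - x) / x ^ 3) (𝓝[≠] 0) (𝓝 (-(1 / 2) / 3)) :=
  tendsto_sub_self_div_cube Real.hasDerivAt_sin Real.sin_zero tendsto_cos_sub_one_div_sq

theorem self_div_sinh_mem_Ioo {u : ℝ} (hu : u ≠ 0) : u / Real.sinh u ∈ Set.Ioo (0 : ℝ) 1 := by
  rcases hu.lt_or_gt with h | h
  · have h1 := Real.sinh_neg_iff.2 h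
    have h2 := Real.sinh_lt_self_iff.2 h
    exact ⟨div_pos_of_neg_of_neg h h1, by rw [div_lt_one_of_neg h1]; exact h2⟩
  · have h1 := Real.sinh_pos_iff.2 h
    have h2 := Real.self_lt_sinh_iff.2 h
    exact ⟨div_pos h h1, (div_lt_one h1).2 h2⟩

theorem cos_wSD2 {u : ℝ} (hu : u ≠ 0) :
    Real.cos (wSD2 u) = √(1 - (u / Real.sinh u) ^ 2) := by
  rw [wSD2, if_neg hu, Real.cos_arcsin]

theorem cos_wSD2_pos {u : ℝ} (hu : u ≠ 0) : 0 < Real.cos (wSD2 u) := by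
  have h := self_div_sinh_mem_Ioo hu
  rw [cos_wSD2 hu, Real.sqrt_pos]
  nlinarith [h.1, h.2]

theorem tendsto_cos_wSD2_div_abs :
    Tendsto (fun u => Real.cos (wSD2 u) / |u|) (𝓝[≠] 0) (𝓝 (√(1 / 3))) := by
  have h := ((tendsto_sinh_sub_self_div_cube.mul (tendsto_sinh_div_self.add_const 1)).div
    (tendsto_sinh_div_self.pow 2) (by norm_num)).sqrt
  rw [show (1 / 2 / 3 * (1 + 1) / 1 ^ 2 : ℝ) = 1 / 3 by norm_num] at h
  refine h.congr' ?_
  filter_upwards [self_mem_nhdsWithin] with u hu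
  have hu : u ≠ 0 := hu
  have hs : Real.sinh u ≠ 0 := Real.sinh_ne_zero.2 hu
  rw [cos_wSD2 hu, ← Real.sqrt_sq_eq_abs, ← Real.sqrt_div' _ (sq_nonneg u)]
  congr 1
  simp only [Pi.div_apply]
  field_simp
  ring

theorem tendsto_wSD2 : Tendsto wSD2 (𝓝[≠] 0) (𝓝 (Real.pi / 2)) := by
  have h := (Real.continuous_arcsin.tendsto 1).comp
    ((tendsto_sinh_div_self.inv₀ one_ne_zero).trans (by simp))
  rw [Real.arcsin_one] at h
  refine h.congr' ?_
  filter_upwards [self_mem_nhdsWithin] with u hu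
  have hu : u ≠ 0 := hu
  simp [wSD2, hu]

theorem hasDerivAt_wSD2 {u : ℝ} (hu : u ≠ 0) :
    HasDerivAt wSD2 (-((u * Real.cosh u - Real.sinh u) / (Real.sinh u ^ 2 * Real.cos (wSD2 u)))) u := by
  have h := self_div_sinh_mem_Ioo hu
  have hs : Real.sinh u ≠ 0 := Real.sinh_ne_zero.2 hu
  have hc := (cos_wSD2_pos hu).ne'
  have h1 := (Real.hasDerivAt_arcsin (by linarith [h.1]) h.2.ne).comp u
    ((hasDerivAt_id u).div (Real.hasDerivAt_sinh u) hs)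
  have h2 : wSD2 =ᶠ[𝓝 u] fun u => Real.arcsin (u / Real.sinh u) := by
    filter_upwards [isOpen_ne.mem_nhds hu] with x hx
    have hx : x ≠ 0 := hx
    simp [wSD2, hx]
  refine (h1.congr_of_eventuallyEq h2).congr_deriv ?_
  simp only [id]
  rw [← cos_wSD2 hu]
  field_simp
  ring

theorem tendsto_pi_div_two_sub_wSD2 :
    Tendsto (fun u => Real.pi / 2 - wSD2 u) (𝓝[≠] 0) (𝓝[≠] 0) := by
  refine tendsto_nhdsWithin_iff.2 ⟨by simpa using tendsto_wSD2.const_sub (Real.pi / 2), ?_⟩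
  filter_upwards [self_mem_nhdsWithin] with u hu h0
  have h := cos_wSD2_pos hu
  rw [← Real.sin_pi_div_two_sub, show Real.pi / 2 - wSD2 u = 0 from h0, Real.sin_zero] at h
  exact h.false

theorem tendsto_pi_div_two_sub_wSD2_div_abs :
    Tendsto (fun u => (Real.pi / 2 - wSD2 u) / |u|) (𝓝[≠] 0) (𝓝 (√(1 / 3))) := by
  have h := tendsto_cos_wSD2_div_abs.div
    (tendsto_sin_div_self.comp tendsto_pi_div_two_sub_wSD2) one_ne_zero
  rw [div_one] at h
  refine h.congr' ?_
  filter_upwards [self_mem_nhdsWithin,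
    tendsto_pi_div_two_sub_wSD2.eventually self_mem_nhdsWithin] with u hu hv
  have hv : Real.pi / 2 - wSD2 u ≠ 0 := hv
  have hc := (cos_wSD2_pos hu).ne'
  simp only [Function.comp, Pi.div_apply, Real.sin_pi_div_two_sub]
  field_simp

/-- The decrease of the phase along the steepest-descent path, relative to the saddle point. -/
noncomputable def phaseDrop (u : ℝ) : ℝ :=
  Real.cosh u * Real.cos (wSD2 u) + wSD2 u - Real.pi / 2

theorem tendsto_phaseDrop_div_abs_cube :
    Tendsto (fun u => phaseDrop u / |u| ^ 3) (𝓝[≠] 0) (𝓝 (4 / 9 * √(1 / 3))) := by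
  have h := (tendsto_cosh_sub_one_div_sq.mul tendsto_cos_wSD2_div_abs).add
    ((tendsto_sin_sub_self_div_cube.comp tendsto_pi_div_two_sub_wSD2).mul
      (tendsto_pi_div_two_sub_wSD2_div_abs.pow 3))
  have hsq : √(1 / 3 : ℝ) ^ 2 = 1 / 3 := Real.sq_sqrt (by norm_num)
  have hl : 1 / 2 * √(1 / 3) + -(1 / 2) / 3 * √(1 / 3) ^ 3 = 4 / 9 * √(1 / 3 : ℝ) := by
    rw [pow_succ, hsq]
    ring
  rw [hl] at h
  refine h.congr' ?_
  filter_upwards [self_mem_nhdsWithin,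
    tendsto_pi_div_two_sub_wSD2.eventually self_mem_nhdsWithin] with u hu hv
  have hv : Real.pi / 2 - wSD2 u ≠ 0 := hv
  have hu : |u| ≠ 0 := abs_ne_zero.2 hu
  simp only [Function.comp, Real.sin_pi_div_two_sub, phaseDrop]
  rw [← sq_abs u, div_pow]
  generalize |u| = a at *
  generalize hq : Real.pi / 2 - wSD2 u = q at *
  rw [show Real.cosh u * Real.cos (wSD2 u) + wSD2 u - Real.pi / 2
    = Real.cosh u * Real.cos (wSD2 u) - q by rw [← hq]; ring]
  field_simp
  ring

theorem tendsto_deriv_wSD2_mul_abs_div :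
    Tendsto (fun u => deriv wSD2 u * (|u| / u)) (𝓝[≠] 0) (𝓝 (-√(1 / 3))) := by
  have hp : 0 < √(1 / 3 : ℝ) := Real.sqrt_pos.2 (by norm_num)
  have h := ((tendsto_cosh_sub_one_div_sq.sub tendsto_sinh_sub_self_div_cube).div
    ((tendsto_sinh_div_self.pow 2).mul tendsto_cos_wSD2_div_abs) (by simp)).neg
  have hsq : √(1 / 3 : ℝ) ^ 2 = 1 / 3 := Real.sq_sqrt (by norm_num)
  have hl : (1 / 2 - 1 / 2 / 3) / (1 ^ 2 * √(1 / 3 : ℝ)) = √(1 / 3) := by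
    rw [div_eq_iff (by simp), one_pow, one_mul, ← sq, hsq]
    norm_num
  rw [hl] at h
  refine h.congr' ?_
  filter_upwards [self_mem_nhdsWithin] with u hu
  have hu : u ≠ 0 := hu
  have hs : Real.sinh u ≠ 0 := Real.sinh_ne_zero.2 hu
  have ha : |u| ≠ 0 := abs_ne_zero.2 hu
  have hc := (cos_wSD2_pos hu).ne'
  rw [(hasDerivAt_wSD2 hu).deriv]
  simp only [Pi.div_apply]
  field_simp
  ring

theorem measurable_wSD2 : Measurable wSD2 :=
  Measurable.ite (measurableSet_singleton 0) measurable_const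
    (Real.measurable_arcsin.comp (measurable_id.div Real.measurable_sinh))

theorem measurable_phaseDrop : Measurable phaseDrop :=
  ((Real.measurable_cosh.mul (Real.measurable_cos.comp measurable_wSD2)).add
    measurable_wSD2).sub_const _

/-- The steepest-descent integrand, normalized by its exponential factor at the saddle point. -/
noncomputable def normalizedIntegrand (r y u : ℝ) : ℂ :=
  Complex.exp (-(y * phaseDrop u : ℝ)) * Complex.exp (r * u : ℝ) *
    Complex.exp (Complex.I * (r * (wSD2 u - Real.pi / 2) : ℝ)) *
    (1 + Complex.I * (deriv wSD2 u : ℝ))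

theorem measurable_normalizedIntegrand (r y : ℝ) : Measurable (normalizedIntegrand r y) := by
  have h1 := measurable_wSD2
  have h2 := measurable_phaseDrop
  have h3 := measurable_deriv wSD2
  unfold normalizedIntegrand
  fun_prop

/-- The rescaled limit of the normalized integrand. -/
noncomputable def limitIntegrand (s : ℝ) : ℂ :=
  (Real.exp (-(4 / 9 * √(1 / 3)) * |s| ^ (3 : ℝ)) : ℝ) *
    (1 + Complex.I * (-√(1 / 3) * (s / |s|) : ℝ))

theorem tendsto_mul_rpow_neg_third {s : ℝ} (hs : s ≠ 0) :
    Tendsto (fun y : ℝ => s * y ^ (-(1 : ℝ) / 3)) atTop (𝓝[≠] 0) := by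
  refine tendsto_nhdsWithin_iff.2 ⟨?_, ?_⟩
  · have h := (tendsto_rpow_neg_atTop (show (0 : ℝ) < 1 / 3 by norm_num)).const_mul s
    rw [mul_zero] at h
    refine h.congr fun y => ?_
    norm_num
  · filter_upwards [eventually_gt_atTop 0] with y hy
    exact mul_ne_zero hs (Real.rpow_pos_of_pos hy _).ne'

theorem mul_rpow_neg_third_cube {y : ℝ} (hy : 0 < y) : y * (y ^ (-(1 : ℝ) / 3)) ^ 3 = 1 := by
  rw [← Real.rpow_natCast, ← Real.rpow_mul hy.le]
  norm_num
  rw [Real.rpow_neg_one, mul_inv_cancel₀ hy.ne']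

theorem rpow_three_eq (x : ℝ) : x ^ (3 : ℝ) = x ^ 3 := by
  exact_mod_cast Real.rpow_natCast x 3

theorem tendsto_normalizedIntegrand (r : ℝ) {s : ℝ} (hs : s ≠ 0) :
    Tendsto (fun y : ℝ => normalizedIntegrand r y (s * y ^ (-(1 : ℝ) / 3))) atTop
      (𝓝 (limitIntegrand s)) := by
  have hu := tendsto_mul_rpow_neg_third hs
  have h1 : Tendsto (fun y : ℝ => y * phaseDrop (s * y ^ (-(1 : ℝ) / 3))) atTop
      (𝓝 (4 / 9 * √(1 / 3) * |s| ^ (3 : ℝ))) := by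
    refine ((tendsto_phaseDrop_div_abs_cube.comp hu).mul_const (|s| ^ (3 : ℝ))).congr' ?_
    filter_upwards [eventually_gt_atTop 0] with y hy
    have hp := Real.rpow_pos_of_pos hy (-(1 : ℝ) / 3)
    have h3 := mul_rpow_neg_third_cube hy
    simp only [Function.comp]
    rw [abs_mul, abs_of_pos hp, mul_pow, rpow_three_eq]
    have := abs_ne_zero.2 hs
    generalize y ^ (-(1 : ℝ) / 3) = x at *
    field_simp
    linear_combination (-phaseDrop (s * x)) * h3
  have h2 : Tendsto (fun y : ℝ => r * (s * y ^ (-(1 : ℝ) / 3))) atTop (𝓝 0) := by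
    simpa using (tendsto_nhds_of_tendsto_nhdsWithin hu).const_mul r
  have h3 : Tendsto (fun y : ℝ => r * (wSD2 (s * y ^ (-(1 : ℝ) / 3)) - Real.pi / 2)) atTop
      (𝓝 0) := by
    simpa using ((tendsto_wSD2.comp hu).sub_const (Real.pi / 2)).const_mul r
  have h4 : Tendsto (fun y : ℝ => deriv wSD2 (s * y ^ (-(1 : ℝ) / 3))) atTop
      (𝓝 (-√(1 / 3) * (s / |s|))) := by
    refine ((tendsto_deriv_wSD2_mul_abs_div.comp hu).mul_const (s / |s|)).congr' ?_
    filter_upwards [eventually_gt_atTop 0] with y hy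
    have hp := Real.rpow_pos_of_pos hy (-(1 : ℝ) / 3)
    have := abs_ne_zero.2 hs
    simp only [Function.comp]
    rw [abs_mul, abs_of_pos hp]
    field_simp
  have e {f : ℝ → ℝ} {a : ℝ} (h : Tendsto f atTop (𝓝 a)) :
      Tendsto (fun y => (f y : ℂ)) atTop (𝓝 (a : ℂ)) :=
    (Complex.continuous_ofReal.tendsto a).comp h
  have h := (((e h1.neg).cexp.mul (e h2).cexp).mul ((e h3).const_mul Complex.I).cexp).mul
    (((e h4).const_mul Complex.I).const_add 1)
  convert h using 2
  · simp [normalizedIntegrand]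
  · simp [limitIntegrand]

theorem integral_exp_neg_mul_abs_cube {b : ℝ} (hb : 0 < b) :
    ∫ s : ℝ, Real.exp (-b * |s| ^ (3 : ℝ)) =
      2 * (b ^ (-1 / 3 : ℝ) * (1 / 3 * Real.Gamma (1 / 3))) := by
  rw [integral_comp_abs (f := fun s : ℝ => Real.exp (-b * s ^ (3 : ℝ))),
    integral_exp_neg_mul_rpow (by norm_num) hb, Real.Gamma_add_one (by norm_num)]

theorem integrable_exp_neg_mul_abs_cube {b : ℝ} (hb : 0 < b) :
    Integrable fun s : ℝ => Real.exp (-b * |s| ^ (3 : ℝ)) := by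
  refine Integrable.of_integral_ne_zero ?_
  rw [integral_exp_neg_mul_abs_cube hb]
  have := Real.Gamma_pos_of_pos (show (0 : ℝ) < 1 / 3 by norm_num)
  positivity

theorem four_ninths_mul_sqrt_rpow :
    (4 / 9 * √(1 / 3 : ℝ)) ^ (-1 / 3 : ℝ) = 3 / (2 ^ ((2 : ℝ) / 3) * 3 ^ ((1 : ℝ) / 6)) := by
  have h : 4 / 9 * √(1 / 3 : ℝ) = 2 ^ (2 : ℝ) * 3 ^ (-5 / 2 : ℝ) := by
    rw [Real.sqrt_eq_rpow, one_div, Real.inv_rpow (by norm_num), ← Real.rpow_neg (by norm_num),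
      show (-5 / 2 : ℝ) = -(1 / 2) + (-2 : ℤ) by norm_num, Real.rpow_add (by norm_num),
      Real.rpow_intCast]
    norm_num
    ring
  rw [h, Real.mul_rpow (by positivity) (by positivity), ← Real.rpow_mul (by norm_num),
    ← Real.rpow_mul (by norm_num), eq_div_iff (by positivity)]
  calc (2 : ℝ) ^ ((2 : ℝ) * (-1 / 3)) * 3 ^ ((-5 / 2 : ℝ) * (-1 / 3)) *
        (2 ^ ((2 : ℝ) / 3) * 3 ^ ((1 : ℝ) / 6))
      = (2 ^ ((2 : ℝ) * (-1 / 3)) * 2 ^ ((2 : ℝ) / 3)) *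
        (3 ^ ((-5 / 2 : ℝ) * (-1 / 3)) * 3 ^ ((1 : ℝ) / 6)) := by ring
    _ = 3 := by
      rw [← Real.rpow_add (by norm_num), ← Real.rpow_add (by norm_num)]
      norm_num

theorem integral_limitIntegrand :
    ∫ s, limitIntegrand s = (2 * (Real.Gamma (1 / 3) /
      (2 ^ ((2 : ℝ) / 3) * 3 ^ ((1 : ℝ) / 6))) : ℝ) := by
  have hb : 0 < 4 / 9 * √(1 / 3 : ℝ) := by positivity
  have hE := integrable_exp_neg_mul_abs_cube hb
  have hsplit (s : ℝ) : limitIntegrand s =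
      (Real.exp (-(4 / 9 * √(1 / 3)) * |s| ^ (3 : ℝ)) : ℝ) + Complex.I * (-√(1 / 3) : ℝ) *
        (Real.exp (-(4 / 9 * √(1 / 3)) * |s| ^ (3 : ℝ)) * (s / |s|) : ℝ) := by
    rw [limitIntegrand]
    push_cast
    ring
  simp only [hsplit]
  generalize hc : 4 / 9 * √(1 / 3 : ℝ) = c at *
  have hO : Integrable fun s : ℝ => Real.exp (-c * |s| ^ (3 : ℝ)) * (s / |s|) := by
    refine hE.mono' (by fun_prop) (Eventually.of_forall fun s => ?_)
    rw [norm_mul, Real.norm_eq_abs, Real.norm_eq_abs, abs_of_pos (Real.exp_pos _), abs_div, abs_abs]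
    exact mul_le_of_le_one_right (Real.exp_pos _).le (div_self_le_one _)
  have hodd : ∫ s : ℝ, Real.exp (-c * |s| ^ (3 : ℝ)) * (s / |s|) = 0 := by
    have h := integral_neg_eq_self (fun s : ℝ => Real.exp (-c * |s| ^ (3 : ℝ)) * (s / |s|)) volume
    simp only [abs_neg, neg_div, mul_neg, integral_neg] at h
    linarith
  rw [integral_add hE.ofReal (hO.ofReal.const_mul _), integral_const_mul, integral_complex_ofReal,
    integral_complex_ofReal, hodd, Complex.ofReal_zero, mul_zero, add_zero,
    integral_exp_neg_mul_abs_cube hb, ← hc, four_ninths_mul_sqrt_rpow]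
  congr 1
  ring

theorem norm_normalizedIntegrand_le (r : ℝ) : ∃ ε > 0, ∀ y > 0, ∀ s : ℝ, s ≠ 0 →
    |s * y ^ (-(1 : ℝ) / 3)| < ε → ‖normalizedIntegrand r y (s * y ^ (-(1 : ℝ) / 3))‖ ≤
      Real.exp (-(2 / 9 * √(1 / 3)) * |s| ^ (3 : ℝ)) * (Real.exp (|r| * ε) * 2) := by
  have hp : 0 < √(1 / 3 : ℝ) := Real.sqrt_pos.2 (by norm_num)
  have hp1 : √(1 / 3 : ℝ) < 1 := by
    rw [Real.sqrt_lt' one_pos]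
    norm_num
  have e1 := tendsto_phaseDrop_div_abs_cube.eventually
    (lt_mem_nhds (show 2 / 9 * √(1 / 3 : ℝ) < 4 / 9 * √(1 / 3) by linarith))
  have e2 := tendsto_deriv_wSD2_mul_abs_div.abs.eventually
    (gt_mem_nhds (show |(-√(1 / 3 : ℝ))| < 1 by rwa [abs_neg, abs_of_pos hp]))
  obtain ⟨ε, hε, H⟩ := Metric.eventually_nhds_iff.1 (eventually_nhdsWithin_iff.1 (e1.and e2))
  refine ⟨ε, hε, fun y hy s hs hsε => ?_⟩
  have hx := Real.rpow_pos_of_pos hy (-(1 : ℝ) / 3)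
  have hu0 : s * y ^ (-(1 : ℝ) / 3) ≠ 0 := mul_ne_zero hs hx.ne'
  obtain ⟨b1, b2⟩ := H (by simpa [dist_zero_right] using hsε) hu0
  have h3 : y * |s * y ^ (-(1 : ℝ) / 3)| ^ 3 = |s| ^ (3 : ℝ) := by
    rw [abs_mul, abs_of_pos hx, rpow_three_eq]
    linear_combination |s| ^ 3 * mul_rpow_neg_third_cube hy
  generalize s * y ^ (-(1 : ℝ) / 3) = u at *
  have hu : 0 < |u| := abs_pos.2 hu0
  rw [abs_mul, abs_div, abs_abs, div_self hu.ne', mul_one] at b2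
  rw [lt_div_iff₀ (by positivity)] at b1
  simp only [normalizedIntegrand, norm_mul]
  rw [mul_assoc, mul_assoc]
  gcongr ?_ * ?_
  · rw [← Complex.ofReal_neg, Complex.norm_exp_ofReal]
    gcongr
    rw [← h3]
    nlinarith
  · rw [Complex.norm_exp_ofReal, Complex.norm_exp_I_mul_ofReal, one_mul]
    gcongr ?_ * ?_
    · refine Real.exp_le_exp.2 ?_
      calc r * u ≤ |r| * |u| := by rw [← abs_mul]; exact le_abs_self _
        _ ≤ |r| * ε := by gcongr
    · refine (norm_add_le _ _).trans ?_
      rw [norm_one, norm_mul, Complex.norm_I, one_mul, Complex.norm_real, Real.norm_eq_abs]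
      linarith

theorem tendsto_integral_normalizedIntegrand {δ : ℝ} (hδ0 : 0 < δ) (hδ : δ < 1 / 3) (r : ℝ) :
    Tendsto (fun y : ℝ => ∫ s in (-(y ^ (1 / 3 - δ)))..(y ^ (1 / 3 - δ)),
      normalizedIntegrand r y (s * y ^ (-(1 : ℝ) / 3))) atTop (𝓝 (∫ s, limitIntegrand s)) := by
  obtain ⟨ε, hε, H⟩ := norm_normalizedIntegrand_le r
  have hp : 0 < √(1 / 3 : ℝ) := Real.sqrt_pos.2 (by norm_num)
  have key : Tendsto (fun y : ℝ => ∫ s, (Set.Ioc (-(y ^ (1 / 3 - δ))) (y ^ (1 / 3 - δ))).indicator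
      (fun s => normalizedIntegrand r y (s * y ^ (-(1 : ℝ) / 3))) s) atTop
      (𝓝 (∫ s, limitIntegrand s)) := by
    refine tendsto_integral_filter_of_dominated_convergence
      (fun s => Real.exp (-(2 / 9 * √(1 / 3)) * |s| ^ (3 : ℝ)) * (Real.exp (|r| * ε) * 2))
      ?_ ?_ ((integrable_exp_neg_mul_abs_cube (by positivity)).mul_const _) ?_
    · refine Eventually.of_forall fun y => Measurable.aestronglyMeasurable ?_
      exact ((measurable_normalizedIntegrand r y).comp
        (measurable_id.mul_const _)).indicator measurableSet_Ioc
    · filter_upwards [eventually_gt_atTop 0,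
        (tendsto_rpow_neg_atTop hδ0).eventually (gt_mem_nhds hε)] with y hy hyε
      filter_upwards [compl_mem_ae_iff.2 (measure_singleton (0 : ℝ))] with s hs
      have hs : s ≠ 0 := hs
      by_cases hm : s ∈ Set.Ioc (-(y ^ (1 / 3 - δ))) (y ^ (1 / 3 - δ))
      · rw [Set.indicator_of_mem hm]
        refine H y hy s hs ?_
        have hx := Real.rpow_pos_of_pos hy (-(1 : ℝ) / 3)
        rw [abs_mul, abs_of_pos hx]
        calc |s| * y ^ (-(1 : ℝ) / 3) ≤ y ^ (1 / 3 - δ) * y ^ (-(1 : ℝ) / 3) := by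
              gcongr
              exact abs_le.2 ⟨hm.1.le, hm.2⟩
          _ = y ^ (-δ) := by
              rw [← Real.rpow_add hy]
              congr 1
              ring
          _ < ε := hyε
      · rw [Set.indicator_of_notMem hm, norm_zero]
        positivity
    · filter_upwards [compl_mem_ae_iff.2 (measure_singleton (0 : ℝ))] with s hs
      refine (tendsto_normalizedIntegrand r hs).congr' ?_
      filter_upwards [(tendsto_rpow_atTop (sub_pos.2 hδ)).eventually_gt_atTop |s|] with y hy
      have hm : s ∈ Set.Ioc (-(y ^ (1 / 3 - δ))) (y ^ (1 / 3 - δ)) :=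
        ⟨(abs_lt.1 hy).1, (abs_lt.1 hy).2.le⟩
      rw [Set.indicator_of_mem hm]
  refine key.congr' ?_
  filter_upwards [eventually_gt_atTop 0] with y hy
  have := Real.rpow_pos_of_pos hy (1 / 3 - δ)
  rw [integral_indicator measurableSet_Ioc, intervalIntegral.integral_of_le (by linarith)]

theorem saddle_point_neighborhood_dominant_term_order_two (M δ : ℝ) (hM : 0 ≤ M)
    (hδ1 : 1 / 4 < δ) (hδ2 : δ < 1 / 3) (r : ℝ) (hr : |r| ≤ M) :
    Tendsto (fun y : ℝ =>
      ((1 / 2) * ∫ u in (-(y ^ (-δ)))..(y ^ (-δ)),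
        Complex.exp (-(y : ℂ) *
            ((Real.cosh u * Real.cos (wSD2 u) + wSD2 u : ℝ) : ℂ)) *
          Complex.exp ((r : ℂ) * (u : ℂ)) *
          Complex.exp (Complex.I * (r : ℂ) * ((wSD2 u : ℝ) : ℂ)) *
          (1 + Complex.I * ((deriv wSD2 u : ℝ) : ℂ))) /
        (Complex.exp (-(((Real.pi / 2) : ℝ) : ℂ) * (y : ℂ) +
            Complex.I * (((Real.pi / 2) : ℝ) : ℂ) * (r : ℂ)) *
          ((y ^ (-(1 : ℝ) / 3) : ℝ) : ℂ) *
          ((Real.Gamma (1 / 3) / (2 ^ ((2 : ℝ) / 3) * 3 ^ ((1 : ℝ) / 6)) : ℝ) : ℂ)))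
      atTop (𝓝 1) := by
  have hlim := tendsto_integral_normalizedIntegrand (by linarith) hδ2 r
  rw [integral_limitIntegrand] at hlim
  have hC : 0 < Real.Gamma (1 / 3) / (2 ^ ((2 : ℝ) / 3) * 3 ^ ((1 : ℝ) / 6)) :=
    div_pos (Real.Gamma_pos_of_pos (by norm_num)) (by positivity)
  generalize Real.Gamma (1 / 3) / (2 ^ ((2 : ℝ) / 3) * 3 ^ ((1 : ℝ) / 6)) = C at *
  have hC' : (C : ℂ) ≠ 0 := Complex.ofReal_ne_zero.2 hC.ne'
  have h := hlim.div_const (2 * C : ℂ)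
  rw [Complex.ofReal_mul, Complex.ofReal_ofNat, div_self (by simpa using hC')] at h
  refine h.congr' ?_
  filter_upwards [eventually_gt_atTop 0] with y hy
  have hx := Real.rpow_pos_of_pos hy (-(1 : ℝ) / 3)
  have hx' : ((y ^ (-(1 : ℝ) / 3) : ℝ) : ℂ) ≠ 0 := Complex.ofReal_ne_zero.2 hx.ne'
  have hfac (u : ℝ) : Complex.exp (-(y : ℂ) *
        ((Real.cosh u * Real.cos (wSD2 u) + wSD2 u : ℝ) : ℂ)) *
        Complex.exp ((r : ℂ) * (u : ℂ)) *
        Complex.exp (Complex.I * (r : ℂ) * ((wSD2 u : ℝ) : ℂ)) *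
        (1 + Complex.I * ((deriv wSD2 u : ℝ) : ℂ)) =
      Complex.exp (-(((Real.pi / 2) : ℝ) : ℂ) * (y : ℂ) +
        Complex.I * (((Real.pi / 2) : ℝ) : ℂ) * (r : ℂ)) * normalizedIntegrand r y u := by
    rw [normalizedIntegrand, ← mul_assoc]
    congr 1
    simp only [← Complex.exp_add, phaseDrop]
    congr 1
    push_cast
    ring
  have hend : y ^ (1 / 3 - δ) * y ^ (-(1 : ℝ) / 3) = y ^ (-δ) := by
    rw [← Real.rpow_add hy]
    congr 1
    ring
  have hE := Complex.exp_ne_zero (-(((Real.pi / 2) : ℝ) : ℂ) * (y : ℂ) +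
    Complex.I * (((Real.pi / 2) : ℝ) : ℂ) * (r : ℂ))
  simp only [hfac, intervalIntegral.integral_const_mul]
  have hsub := intervalIntegral.smul_integral_comp_mul_right (a := -(y ^ (1 / 3 - δ)))
    (b := y ^ (1 / 3 - δ)) (normalizedIntegrand r y) (y ^ (-(1 : ℝ) / 3))
  rw [neg_mul, hend, Complex.real_smul] at hsub
  rw [← hsub]
  generalize (∫ s in (-(y ^ (1 / 3 - δ)))..(y ^ (1 / 3 - δ)),
    normalizedIntegrand r y (s * y ^ (-(1 : ℝ) / 3))) = J
  generalize ((y ^ (-(1 : ℝ) / 3) : ℝ) : ℂ) = x at *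
  field_simp
end

section
/- Fix μ > 0 and let w_A, w_B be the contour branches. Define w(u) := w_A(u) for u ≥ μ and w(u) := w_B(u) for u ≤ μ (near μ). Then as ρ → 0: cosh(μ+ρ) · cos(w(μ+ρ)) + w(μ+ρ) · cosh μ = (π/2) cosh μ + (sinh μ) ρ² + O(ρ³); moreover, using instead the branch w_A on both sides of μ, cosh(μ+ρ) · cos(w_A(μ+ρ)) + w_A(μ+ρ) · cosh μ = (π/2) cosh μ − (sinh μ) ρ² + O(ρ³) as ρ → 0⁻. -/
open Filter Topology Asymptotics

/-- `g(u) = (u cosh μ + sinh μ − μ cosh μ)/sinh u`. -/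
noncomputable def gContour (μ u : ℝ) : ℝ :=
  (u * Real.cosh μ + Real.sinh μ - μ * Real.cosh μ) / Real.sinh u

/-- The branch `w_A(u) = arcsin(g(u))`. -/
noncomputable def wA (μ u : ℝ) : ℝ := Real.arcsin (gContour μ u)

/-- The branch `w_B(u) = π − arcsin(g(u))`. -/
noncomputable def wB (μ u : ℝ) : ℝ := Real.pi - Real.arcsin (gContour μ u)

/-- The combined branch: `w_B` for `u ≤ μ`, `w_A` for `u ≥ μ`. -/
noncomputable def wBranch (μ u : ℝ) : ℝ := if u ≤ μ then wB μ u else wA μ u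

theorem Real.exp_sub_quadratic_isBigO :
    (fun x : ℝ => Real.exp x - (1 + x + x ^ 2 / 2)) =O[𝓝 0] (fun x : ℝ => x ^ 3) := by
  simpa [Finset.sum_range_succ] using Real.exp_sub_sum_range_isBigO_pow 3

theorem Real.exp_neg_sub_quadratic_isBigO :
    (fun x : ℝ => Real.exp (-x) - (1 - x + x ^ 2 / 2)) =O[𝓝 0] (fun x : ℝ => x ^ 3) := by
  have h := Real.exp_sub_quadratic_isBigO.comp_tendsto
    (continuous_neg.tendsto' (0 : ℝ) 0 neg_zero)
  refine (h.congr (fun x => ?_) fun x => ?_).of_neg_right <;>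
  · simp only [Function.comp_apply]; ring

theorem Real.cosh_sub_quadratic_isBigO :
    (fun x : ℝ => Real.cosh x - 1 - x ^ 2 / 2) =O[𝓝 0] (fun x : ℝ => x ^ 3) := by
  refine ((Real.exp_sub_quadratic_isBigO.add
    Real.exp_neg_sub_quadratic_isBigO).const_mul_left (1 / 2)).congr_left fun x => ?_
  rw [Real.cosh_eq]; ring

theorem Real.sinh_sub_self_isBigO :
    (fun x : ℝ => Real.sinh x - x) =O[𝓝 0] (fun x : ℝ => x ^ 3) := by
  refine ((Real.exp_sub_quadratic_isBigO.sub
    Real.exp_neg_sub_quadratic_isBigO).const_mul_left (1 / 2)).congr_left fun x => ?_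
  rw [Real.sinh_eq]; ring

theorem isBigO_cube_sq : (fun x : ℝ => x ^ 3) =O[𝓝 0] (fun x : ℝ => x ^ 2) :=
  (isLittleO_pow_pow (by norm_num)).isBigO

theorem isBigO_sq_id : (fun x : ℝ => x ^ 2) =O[𝓝 0] (fun x : ℝ => x) := by
  simpa using (isLittleO_pow_pow (𝕜 := ℝ) (m := 1) (n := 2) (by norm_num)).isBigO

theorem Real.cosh_sub_one_isBigO :
    (fun x : ℝ => Real.cosh x - 1) =O[𝓝 0] (fun x : ℝ => x ^ 2) := by
  refine ((Real.cosh_sub_quadratic_isBigO.trans isBigO_cube_sq).add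
    ((isBigO_refl (fun x : ℝ => x ^ 2) (𝓝 0)).const_mul_left (1 / 2))).congr_left fun x => ?_
  ring

theorem Real.sinh_isBigO : Real.sinh =O[𝓝 0] (fun x : ℝ => x) := by
  refine ((Real.sinh_sub_self_isBigO.trans (isBigO_cube_sq.trans isBigO_sq_id)).add
    (isBigO_refl (fun x : ℝ => x) (𝓝 0))).congr_left fun x => ?_
  ring

theorem Real.cosh_add_sub_isBigO (μ : ℝ) :
    (fun x : ℝ => Real.cosh (μ + x) - Real.cosh μ - Real.sinh μ * x) =O[𝓝 0]
      (fun x : ℝ => x ^ 2) := by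
  refine ((Real.cosh_sub_one_isBigO.const_mul_left (Real.cosh μ)).add
    ((Real.sinh_sub_self_isBigO.trans isBigO_cube_sq).const_mul_left (Real.sinh μ))).congr_left
      fun x => ?_
  rw [Real.cosh_add]; ring

theorem Real.sinh_add_sub_isBigO (μ : ℝ) :
    (fun x : ℝ => Real.sinh (μ + x) - Real.sinh μ) =O[𝓝 0] (fun x : ℝ => x) := by
  refine (((Real.cosh_sub_one_isBigO.trans isBigO_sq_id).const_mul_left (Real.sinh μ)).add
    (Real.sinh_isBigO.const_mul_left (Real.cosh μ))).congr_left fun x => ?_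
  rw [Real.sinh_add]; ring

theorem one_sub_gContour_isBigO {μ : ℝ} (hμ : 0 < μ) :
    (fun ρ : ℝ => 1 - gContour μ (μ + ρ) - ρ ^ 2 / 2) =O[𝓝 0] (fun ρ : ℝ => ρ ^ 3) := by
  have hs : Real.sinh μ ≠ 0 := (Real.sinh_pos_iff.2 hμ).ne'
  have hcont : Tendsto (fun ρ : ℝ => Real.sinh (μ + ρ)) (𝓝 0) (𝓝 (Real.sinh μ)) :=
    Continuous.tendsto' (by fun_prop) _ _ (by simp)
  have hinv : (fun ρ : ℝ => (Real.sinh (μ + ρ))⁻¹) =O[𝓝 0] (fun _ : ℝ => (1 : ℝ)) :=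
    (hcont.inv₀ hs).isBigO_one ℝ
  have hcross : (fun ρ : ℝ => ρ ^ 2 * (Real.sinh (μ + ρ) - Real.sinh μ)) =O[𝓝 0]
      (fun ρ : ℝ => ρ ^ 3) :=
    ((isBigO_refl (fun ρ : ℝ => ρ ^ 2) (𝓝 0)).mul (Real.sinh_add_sub_isBigO μ)).congr_right
      fun ρ => by ring
  have hnum := ((Real.cosh_sub_quadratic_isBigO.const_mul_left (Real.sinh μ)).add
    (Real.sinh_sub_self_isBigO.const_mul_left (Real.cosh μ))).sub
    (hcross.const_mul_left (1 / 2))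
  refine (hinv.mul hnum).congr' ?_ (by simp)
  filter_upwards [hcont.eventually_ne hs] with ρ hρ
  rw [gContour]
  field_simp
  rw [Real.sinh_add]
  ring

theorem arccos_one_sub_isBigO {f : ℝ → ℝ}
    (hf : (fun x : ℝ => f x - x ^ 2 / 2) =O[𝓝 0] (fun x : ℝ => x ^ 3)) :
    (fun x : ℝ => Real.arccos (1 - f x) - |x|) =O[𝓝 0] (fun x : ℝ => x ^ 2) := by
  obtain ⟨C, hC, hb⟩ := hf.exists_pos
  refine IsBigO.of_bound (2 * C + 3) ?_
  have hsmall : ∀ᶠ x : ℝ in 𝓝 0, C * |x| < 1 / 2 :=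
    (Continuous.tendsto' (f := fun x : ℝ => C * |x|) (by fun_prop) 0 0 (by simp)).eventually_lt_const
      (by norm_num)
  have hone : ∀ᶠ x : ℝ in 𝓝 0, |x| < 1 :=
    (continuous_abs.tendsto' (0 : ℝ) 0 (by simp)).eventually_lt_const (by norm_num)
  filter_upwards [hb.bound, hsmall, hone] with x hx hCx hx1
  rw [Real.norm_eq_abs, Real.norm_eq_abs, abs_pow] at hx ⊢
  rw [← sq_abs x] at hx
  set r := |x|
  have hr0 : 0 ≤ r := abs_nonneg x
  set θ := Real.arccos (1 - f x)
  have hcub : C * r ^ 3 ≤ r ^ 2 / 2 := by nlinarith [sq_nonneg r]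
  have hf' := abs_le.1 hx
  have hcos : Real.cos θ = 1 - f x := Real.cos_arccos (by nlinarith) (by nlinarith)
  have hθ0 : 0 ≤ θ := Real.arccos_nonneg _
  have hθπ : θ ≤ Real.pi := Real.arccos_le_pi _
  set s := Real.sin (θ / 2)
  have hs0 : 0 ≤ s := Real.sin_nonneg_of_nonneg_of_le_pi (by linarith) (by linarith)
  have hs2 : 2 * s ^ 2 = f x := by
    have h1 := Real.cos_sq_add_sin_sq (θ / 2)
    have h2 := Real.cos_sq (θ / 2)
    rw [mul_div_cancel₀ θ two_ne_zero, hcos] at h2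
    linarith
  have hsr : s ≤ r := (sq_le_sq₀ hs0 hr0).1 (by linarith [sq_nonneg r])
  have hθs : θ ≤ 4 * s := by
    have hj := Real.mul_le_sin (x := θ / 2) (by linarith) (by linarith)
    have hp : 1 / 2 ≤ 2 / Real.pi := by
      rw [div_le_div_iff₀ (by norm_num) Real.pi_pos]; linarith [Real.pi_le_four]
    nlinarith
  have hx2 : |2 * s - r| ≤ 2 * C * r ^ 2 := by
    rcases hr0.eq_or_lt with h0 | h0
    · have : s = 0 := by linarith
      simp [← h0, this]
    · refine le_of_mul_le_mul_right ?_ h0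
      calc |2 * s - r| * r ≤ |2 * s - r| * |2 * s + r| := by
            gcongr; rw [abs_of_nonneg (by positivity)]; linarith
        _ = 2 * |f x - r ^ 2 / 2| := by
            rw [← abs_mul, ← hs2, ← abs_two (α := ℝ), ← abs_mul, abs_two]; congr 1; ring
        _ ≤ 2 * C * r ^ 2 * r := by nlinarith
  have hsin := Real.abs_sub_sin_le (θ / 2)
  rw [abs_of_nonneg (by linarith : 0 ≤ θ / 2)] at hsin
  have hpow : (θ / 2) ^ 3 ≤ (2 * r) ^ 3 := by gcongr; linarith
  have hr3 : r ^ 3 ≤ r ^ 2 := pow_le_pow_of_le_one hr0 hx1.le (by norm_num)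
  have hsin' := abs_le.1 hsin
  have hx2' := abs_le.1 hx2
  rw [abs_le]
  constructor <;> nlinarith [sq_nonneg r]

theorem phase_arccos_isBigO {μ : ℝ} (hμ : 0 < μ) :
    (fun ρ : ℝ => Real.cosh (μ + ρ) * Real.sin (Real.arccos (gContour μ (μ + ρ))) -
        Real.arccos (gContour μ (μ + ρ)) * Real.cosh μ - Real.sinh μ * (ρ * |ρ|)) =O[𝓝 0]
      (fun ρ : ℝ => ρ ^ 3) := by
  have hd := arccos_one_sub_isBigO (one_sub_gContour_isBigO hμ)
  simp only [sub_sub_cancel] at hd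
  set θ : ℝ → ℝ := fun ρ => Real.arccos (gContour μ (μ + ρ))
  change (fun ρ => θ ρ - |ρ|) =O[𝓝 0] _ at hd
  have hθ : θ =O[𝓝 0] (fun ρ : ℝ => ρ) := by
    refine ((hd.trans isBigO_sq_id).add (isBigO_refl (fun ρ : ℝ => ρ) (𝓝 0)).abs_left).congr_left
      fun ρ => ?_
    simp
  have hsin : (fun ρ => θ ρ - Real.sin (θ ρ)) =O[𝓝 0] (fun ρ : ℝ => ρ ^ 3) := by
    refine IsBigO.trans (IsBigO.of_bound (1 / 6) (Eventually.of_forall fun ρ => ?_)) (hθ.pow 3)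
    have := Real.abs_sub_sin_le (θ ρ)
    rw [Real.norm_eq_abs, Real.norm_eq_abs, abs_pow]
    linarith
  have hcosh : (fun ρ : ℝ => Real.cosh (μ + ρ)) =O[𝓝 0] (fun _ : ℝ => (1 : ℝ)) :=
    (Continuous.tendsto (by fun_prop) 0).isBigO_one ℝ
  have h₁ := (Real.cosh_add_sub_isBigO μ).mul hθ
  have h₂ := ((isBigO_refl (fun ρ : ℝ => ρ) (𝓝 0)).mul hd).const_mul_left (Real.sinh μ)
  have h₃ := hcosh.mul hsin
  refine (((h₁.congr_right fun ρ => ?_).add (h₂.congr_right fun ρ => ?_)).sub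
    (h₃.congr_right fun ρ => ?_)).congr_left fun ρ => ?_
  · ring
  · ring
  · ring
  · change _ = Real.cosh (μ + ρ) * Real.sin (θ ρ) - θ ρ * Real.cosh μ - _
    ring

theorem wA_eq (μ u : ℝ) : wA μ u = Real.pi / 2 - Real.arccos (gContour μ u) := by
  rw [wA, Real.arcsin_eq_pi_div_two_sub_arccos]

theorem wB_eq (μ u : ℝ) : wB μ u = Real.arccos (gContour μ u) + Real.pi / 2 := by
  rw [wB, Real.arcsin_eq_pi_div_two_sub_arccos]; ring

theorem psi_expansion_at_saddle (μ : ℝ) (hμ : 0 < μ) :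
    ((fun ρ : ℝ => Real.cosh (μ + ρ) * Real.cos (wBranch μ (μ + ρ)) +
        wBranch μ (μ + ρ) * Real.cosh μ -
        ((Real.pi / 2) * Real.cosh μ + Real.sinh μ * ρ ^ 2)) =O[𝓝 0]
      (fun ρ : ℝ => ρ ^ 3)) ∧
    ((fun ρ : ℝ => Real.cosh (μ + ρ) * Real.cos (wA μ (μ + ρ)) +
        wA μ (μ + ρ) * Real.cosh μ -
        ((Real.pi / 2) * Real.cosh μ - Real.sinh μ * ρ ^ 2)) =O[𝓝[<] (0 : ℝ)]
      (fun ρ : ℝ => ρ ^ 3)) := by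
  have h := phase_arccos_isBigO hμ
  constructor
  · refine (IsBigO.of_bound 1 (Eventually.of_forall fun ρ => le_of_eq ?_)).trans h
    rw [one_mul, wBranch]
    split_ifs with hρ
    · rw [wB_eq, Real.cos_add_pi_div_two, abs_of_nonpos (by linarith : ρ ≤ 0), ← norm_neg]
      congr 1; ring
    · rw [wA_eq, Real.cos_pi_div_two_sub, abs_of_nonneg (by linarith : 0 ≤ ρ)]
      congr 1; ring
  · refine (h.mono nhdsWithin_le_nhds).congr' ?_ EventuallyEq.rfl
    filter_upwards [self_mem_nhdsWithin] with ρ hρ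
    rw [wA_eq, Real.cos_pi_div_two_sub, abs_of_neg hρ]
    ring
end
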